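/- arXiv:1509.06543 — 2 statements merged into one kernel-verified Lean document; each statement's English description precedes it below -/
import Mathlib

section
/- Let n = 2 and k be arbitrary. Then U^A_block-diag = U_unital: a unitary operator U on ℂ² ⊗ ℂ^k satisfies L_{U,β}(I_2) = I_2 for every density matrix β ∈ M_k^{1,+}(ℂ) if and only if U = Σ_{i=1}^k U_i ⊗ e_if_i* for some unitaries U_i on ℂ² and orthonormal bases {e_i}, {f_i} of ℂ^k. -/
open Matrix Kronecker ComplexOrder

noncomputable section

namespace BipartiteUnitary

/-- A square complex matrix is unitary. -/
def IsUnitary {m : Type*} [Fintype m] [DecidableEq m] (U : Matrix m m ℂ) : Prop :=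
  U * Uᴴ = 1 ∧ Uᴴ * U = 1

/-- A density matrix: positive semidefinite with unit trace. -/
def IsDensity {m : Type*} [Fintype m] (β : Matrix m m ℂ) : Prop :=
  β.PosSemidef ∧ β.trace = 1

/-- Partial trace over the second tensor factor. -/
def trB {n k : Type*} [Fintype k] (M : Matrix (n × k) (n × k) ℂ) : Matrix n n ℂ :=
  fun i j => ∑ s, M (i, s) (j, s)

/-- Partial trace over the first tensor factor. -/
def trA {n k : Type*} [Fintype n] (M : Matrix (n × k) (n × k) ℂ) : Matrix k k ℂ :=
  fun s t => ∑ i, M (i, s) (i, t)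

/-- The quantum channel `L_{U,β}(X) = Tr_B (U (X ⊗ β) U*)`. -/
def channel {n k : Type*} [Fintype n] [Fintype k]
    (U : Matrix (n × k) (n × k) ℂ) (β : Matrix k k ℂ) (X : Matrix n n ℂ) :
    Matrix n n ℂ :=
  trB (U * (X ⊗ₖ β) * Uᴴ)

/-- The partial transpose `X^Γ = (id ⊗ t)(X)` with respect to the second factor. -/
def pt {n k : Type*} (U : Matrix (n × k) (n × k) ℂ) : Matrix (n × k) (n × k) ℂ :=
  fun p q => U (p.1, q.2) (q.1, p.2)

/-- A family of vectors forming an orthonormal basis of `ℂ^k`. -/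
def ONB {k : Type*} [Fintype k] [DecidableEq k] (e : k → k → ℂ) : Prop :=
  ∀ i j, (∑ s, star (e i s) * e j s) = if i = j then (1 : ℂ) else 0

/-- A partial isometry. -/
def IsPartialIso {m : Type*} [Fintype m] [DecidableEq m] (R : Matrix m m ℂ) : Prop :=
  R * Rᴴ * R = R

/-- Membership in `𝒰^A_{block-diag}`: `U = ∑ i, U_i ⊗ e_i f_i*` with `U_i` unitary
and `{e_i}, {f_i}` orthonormal bases of `ℂ^k`. -/
def memUA {n k : ℕ} (U : Matrix (Fin n × Fin k) (Fin n × Fin k) ℂ) : Prop :=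
  ∃ (Us : Fin k → Matrix (Fin n) (Fin n) ℂ) (e f : Fin k → Fin k → ℂ),
    (∀ i, IsUnitary (Us i)) ∧ ONB e ∧ ONB f ∧
    U = ∑ i, Us i ⊗ₖ vecMulVec (e i) (star (f i))

/-- Membership in `ℳ^A_{block-diag}`: `X = ∑ i, X_i ⊗ e_i f_i*` with arbitrary `X_i`. -/
def memMA {n k : ℕ} (X : Matrix (Fin n × Fin k) (Fin n × Fin k) ℂ) : Prop :=
  ∃ (Xs : Fin k → Matrix (Fin n) (Fin n) ℂ) (e f : Fin k → Fin k → ℂ),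
    ONB e ∧ ONB f ∧ X = ∑ i, Xs i ⊗ₖ vecMulVec (e i) (star (f i))

/-- Membership in `𝒰^B_{block-diag}`. -/
def memUB {n k : ℕ} (U : Matrix (Fin n × Fin k) (Fin n × Fin k) ℂ) : Prop :=
  ∃ (Us : Fin n → Matrix (Fin k) (Fin k) ℂ) (e f : Fin n → Fin n → ℂ),
    (∀ i, IsUnitary (Us i)) ∧ ONB e ∧ ONB f ∧
    U = ∑ i, vecMulVec (e i) (star (f i)) ⊗ₖ Us i

/-- Membership in `ℳ^B_{block-diag}`. -/
def memMB {n k : ℕ} (X : Matrix (Fin n × Fin k) (Fin n × Fin k) ℂ) : Prop :=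
  ∃ (Xs : Fin n → Matrix (Fin k) (Fin k) ℂ) (e f : Fin n → Fin n → ℂ),
    ONB e ∧ ONB f ∧ X = ∑ i, vecMulVec (e i) (star (f i)) ⊗ₖ Xs i

open Module.End in
lemma simdiag {k : ℕ} {ι : Type*} (X : ι → Matrix (Fin k) (Fin k) ℂ)
    (hX : ∀ i, (X i).IsHermitian) (hc : ∀ i j, X i * X j = X j * X i) :
    ∃ (F : Matrix (Fin k) (Fin k) ℂ) (d : ι → Fin k → ℂ), IsUnitary F ∧
      ∀ i, X i * F = F * diagonal (d i) := by
  classical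
  let T : ι → (EuclideanSpace ℂ (Fin k) →ₗ[ℂ] EuclideanSpace ℂ (Fin k)) :=
    fun i => toEuclideanLin (X i)
  have hT : ∀ i, (T i).IsSymmetric := fun i => Matrix.isSymmetric_toEuclideanLin_iff.mpr (hX i)
  have happ : ∀ i v, T i v = WithLp.toLp 2 (X i *ᵥ v.ofLp) := fun i v => rfl
  have hC : Pairwise (Function.onFun Commute T) := by
    intro i j _
    show T i * T j = T j * T i
    ext1 v
    simp [Module.End.mul_apply, happ, mulVec_mulVec, hc i j]
  have hIntl := LinearMap.IsSymmetric.directSum_isInternal_of_pairwise_commute hT hC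
  have horth := LinearMap.IsSymmetric.orthogonalFamily_iInf_eigenspaces hT
  have hIntl2 := (DirectSum.isInternal_ne_bot_iff).mpr hIntl
  let _inst := hIntl.submodule_iSupIndep.fintypeNeBotOfFiniteDimensional
  have horth2 := horth.comp (γ := {χ : ι → ℂ // (⨅ j, eigenspace (T j) (χ j)) ≠ ⊥})
    Subtype.val_injective
  have hn : Module.finrank ℂ (EuclideanSpace ℂ (Fin k)) = k := by simp
  let b := hIntl2.subordinateOrthonormalBasis hn horth2
  let χ := fun a => (hIntl2.subordinateOrthonormalBasisIndex hn a horth2).1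
  have hb : ∀ a i, T i (b a) = χ a i • b a := by
    intro a i
    have := hIntl2.subordinateOrthonormalBasis_subordinate hn a horth2
    have := (Submodule.mem_iInf _).mp this i
    exact mem_eigenspace_iff.mp this
  refine ⟨Matrix.of (fun s t => b t s), fun i a => χ a i, ?_, ?_⟩
  · have h2 : (Matrix.of (fun s t => b t s) : Matrix (Fin k) (Fin k) ℂ)ᴴ *
        (Matrix.of (fun s t => b t s) : Matrix (Fin k) (Fin k) ℂ) = 1 := by
      ext s t
      have := orthonormal_iff_ite.mp b.orthonormal s t
      rw [Matrix.one_apply, ← this, Matrix.mul_apply, PiLp.inner_apply]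
      simp [conjTranspose_apply, mul_comm]
    exact ⟨mul_eq_one_comm.mp h2, h2⟩
  · intro i
    ext s t
    have := congrArg (fun v => v.ofLp s) (hb t i)
    simp only [happ] at this
    rw [Matrix.mul_diagonal]
    simp only [PiLp.smul_apply, smul_eq_mul] at this
    rw [Matrix.of_apply, mul_comm, ← this]
    rfl

lemma simdiag_normal {k : ℕ} {ι : Type*} (X : ι → Matrix (Fin k) (Fin k) ℂ)
    (hc : ∀ i j, X i * X j = X j * X i) (hc' : ∀ i j, X i * (X j)ᴴ = (X j)ᴴ * X i) :
    ∃ (F : Matrix (Fin k) (Fin k) ℂ) (d : ι → Fin k → ℂ), IsUnitary F ∧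
      ∀ i, X i * F = F * diagonal (d i) := by
  have hcc : ∀ i j, (X i)ᴴ * (X j)ᴴ = (X j)ᴴ * (X i)ᴴ := by
    intro i j
    rw [← conjTranspose_mul, ← conjTranspose_mul, hc]
  let Y : ι × Bool → Matrix (Fin k) (Fin k) ℂ := fun p =>
    if p.2 then X p.1 + (X p.1)ᴴ else Complex.I • (X p.1 - (X p.1)ᴴ)
  obtain ⟨F, d, hF, h⟩ := simdiag Y (by
      rintro ⟨i, b⟩
      cases b
      · simp [Y, Matrix.IsHermitian, conjTranspose_smul, ← smul_neg]
      · simp [Y, Matrix.IsHermitian, add_comm]) (by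
      rintro ⟨i, b⟩ ⟨j, b'⟩
      have h1 := hc i j
      have h2 := hc' i j
      have h3 := hc' j i
      have h4 := hcc i j
      cases b <;> cases b' <;>
        simp [Y, mul_add, add_mul, mul_sub, sub_mul, h1, h2, h3, h4] <;> module)
  refine ⟨F, fun i t => (1/2 : ℂ) * d (i, true) t - (Complex.I / 2) * d (i, false) t, hF, ?_⟩
  intro i
  have h1 := h (i, true)
  have h2 := h (i, false)
  have e : X i = (1/2 : ℂ) • Y (i, true) - (Complex.I / 2) • Y (i, false) := by
    ext s t
    simp [Y]
    linear_combination (1/2 : ℂ) * (X i s t - (starRingEnd ℂ) (X i t s)) * Complex.I_mul_I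
  rw [e, sub_mul, smul_mul_assoc, smul_mul_assoc, h1, h2]
  ext s t
  simp [Matrix.mul_diagonal]
  ring

lemma core {k : ℕ} (A B C D : Matrix (Fin k) (Fin k) ℂ) (hA : IsUnit A.det)
    (h1 : Aᴴ * A + Bᴴ * B = 1) (h3 : Cᴴ * A + Dᴴ * B = 0)
    (h4 : A * Aᴴ + B * Bᴴ = 1) (h5 : A * Cᴴ + B * Dᴴ = 0)
    (h8 : Bᴴ * B + Dᴴ * D = 1) (h11 : B * Bᴴ + D * Dᴴ = 1) :
    ∃ (E F : Matrix (Fin k) (Fin k) ℂ) (a b c d : Fin k → ℂ), IsUnitary E ∧ IsUnitary F ∧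
      A = E * diagonal a * Fᴴ ∧ B = E * diagonal b * Fᴴ ∧
      C = E * diagonal c * Fᴴ ∧ D = E * diagonal d * Fᴴ := by
  obtain ⟨R, hAR, hRA⟩ : ∃ R, A * R = 1 ∧ R * A = 1 :=
    ⟨A⁻¹, mul_nonsing_inv _ hA, nonsing_inv_mul _ hA⟩
  have hRA' : Aᴴ * Rᴴ = 1 := by rw [← conjTranspose_mul, hRA, conjTranspose_one]
  have hAR' : Rᴴ * Aᴴ = 1 := by rw [← conjTranspose_mul, hAR, conjTranspose_one]
  obtain ⟨N, rfl⟩ : ∃ N, B = A * N := ⟨R * B, by rw [← mul_assoc, hAR, one_mul]⟩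
  obtain ⟨K, rfl⟩ : ∃ N, C = A * N := ⟨R * C, by rw [← mul_assoc, hAR, one_mul]⟩
  obtain ⟨L, rfl⟩ : ∃ N, D = A * N := ⟨R * D, by rw [← mul_assoc, hAR, one_mul]⟩
  have cl : ∀ X Y, A * X = A * Y → X = Y := fun X Y h => by
    have := congrArg (R * ·) h
    simpa [← mul_assoc, hRA] using this
  have cr : ∀ X Y, X * Aᴴ = Y * Aᴴ → X = Y := fun X Y h => by
    have := congrArg (· * Rᴴ) h
    simpa [mul_assoc, hRA'] using this
  obtain ⟨S, hS⟩ : ∃ S, S = Aᴴ * A := ⟨_, rfl⟩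
  obtain ⟨Q, hQ⟩ : ∃ Q, Q = R * Rᴴ := ⟨_, rfl⟩
  have hSh : Sᴴ = S := by rw [hS]; simp
  have hSQ : S * Q = 1 := by
    rw [hS, hQ, mul_assoc, ← mul_assoc A, hAR, one_mul, hRA']
  have hQS : Q * S = 1 := mul_eq_one_comm.mp hSQ
  have cS : ∀ X Y, S * X = S * Y → X = Y := fun X Y h => by
    have := congrArg (Q * ·) h
    simpa [← mul_assoc, hQS] using this
  have cS' : ∀ X Y, X * S = Y * S → X = Y := fun X Y h => by
    have := congrArg (· * Q) h
    simpa [mul_assoc, hSQ] using this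
  simp only [conjTranspose_mul] at h1 h3 h4 h5 h8 h11
  have hNS : N * S = S * N := by
    apply cl
    have e1 : S = 1 - Nᴴ * Aᴴ * (A * N) := by rw [hS, ← h1]; abel
    have e2 : A * Aᴴ = 1 - A * N * (Nᴴ * Aᴴ) := by rw [← h4]; abel
    have : A * (S * N) = A * Aᴴ * (A * N) := by rw [hS]; simp only [mul_assoc]
    rw [this, e2, e1]
    noncomm_ring
  have hNS' : Nᴴ * S = S * Nᴴ := by
    have := congrArg conjTranspose hNS
    simpa [hSh] using this.symm
  have hLL : Lᴴ * S * L = S := by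
    have : Lᴴ * Aᴴ * (A * L) = Aᴴ * A := by
      have := h8.trans h1.symm
      rw [add_comm] at this
      exact add_right_cancel this
    rw [hS]
    simpa [mul_assoc] using this
  have hDD : A * L * (Lᴴ * Aᴴ) = A * Aᴴ := by
    have := h11.trans h4.symm
    rw [add_comm] at this
    exact add_right_cancel this
  have hL2 : L * Lᴴ = 1 := by
    apply cl; apply cr; simpa [mul_assoc] using hDD
  have hL1 : Lᴴ * L = 1 := mul_eq_one_comm.mp hL2
  have hLS : L * S = S * L := by
    conv_lhs => rw [← hLL]
    rw [mul_assoc, ← mul_assoc, hL2, one_mul]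
  have hLS' : Lᴴ * S = S * Lᴴ := by
    have := congrArg conjTranspose hLS
    simpa [hSh] using this.symm
  have hN1 : 1 + N * Nᴴ = Q := by
    have := congrArg (fun Z => R * Z * Rᴴ) h4
    simp only [mul_one, ← hQ] at this
    rw [← this]
    have e1 : R * (A * Aᴴ + A * N * (Nᴴ * Aᴴ)) * Rᴴ
      = (R * A) * (Aᴴ * Rᴴ) + (R * A) * (N * Nᴴ) * (Aᴴ * Rᴴ) := by noncomm_ring
    rw [e1, hRA, hRA']; simp
  have hN2 : 1 + Nᴴ * N = Q := by
    apply cS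
    have e1 : S * (Nᴴ * N) = Nᴴ * Aᴴ * (A * N) := by
      rw [← mul_assoc, ← hNS', hS]
      simp only [mul_assoc]
    rw [hSQ, mul_add, mul_one, e1, hS]
    exact h1
  have hNN : N * Nᴴ = Nᴴ * N := add_left_cancel (hN1.trans hN2.symm)
  have hK1 : Kᴴ = - (N * Lᴴ) := by
    apply cl; apply cr
    rw [eq_comm, ← sub_eq_zero, ← neg_eq_zero, ← h5]; noncomm_ring
  have hK2 : Kᴴ = - (Lᴴ * N) := by
    apply cS'
    have : Kᴴ * S + Lᴴ * (S * N) = 0 := by rw [← h3, hS]; noncomm_ring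
    rw [← hNS] at this
    rw [eq_neg_of_add_eq_zero_left this]; noncomm_ring
  have hNL' : N * Lᴴ = Lᴴ * N := neg_injective (hK1.symm.trans hK2)
  have hN'L : Nᴴ * L = L * Nᴴ := by
    have := congrArg conjTranspose hNL'
    simpa using this.symm
  have hNL : N * L = L * N := by
    calc N * L = L * Lᴴ * N * L := by rw [hL2, one_mul]
      _ = L * (N * Lᴴ) * L := by rw [hNL']; simp only [mul_assoc]
      _ = L * N * (Lᴴ * L) := by simp only [mul_assoc]
      _ = L * N := by rw [hL1, mul_one]
  have hK : K = - (L * Nᴴ) := by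
    have := congrArg conjTranspose hK1
    simpa using this
  obtain ⟨F, d, hF, hd⟩ := simdiag_normal ![S, N, L] (by
      intro i j
      fin_cases i <;> fin_cases j <;> simp [hNS, hLS, hNL])
    (by
      intro i j
      fin_cases i <;> fin_cases j <;> simp [hNS, hLS, hNL, hSh, hNS', hLS', hNN, hNL', hN'L, hL1, hL2])
  have hdS : S * F = F * diagonal (d 0) := hd 0
  have hdN : N * F = F * diagonal (d 1) := hd 1
  have hdL : L * F = F * diagonal (d 2) := hd 2
  have toF : ∀ X x, X * F = F * diagonal x → X = F * diagonal x * Fᴴ := fun X x h => by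
    rw [← h, mul_assoc, hF.1, mul_one]
  have eS := toF _ _ hdS
  have eN := toF _ _ hdN
  have eL := toF _ _ hdL
  have eN' : Nᴴ = F * diagonal (star (d 1)) * Fᴴ := by
    rw [eN]; simp [diagonal_conjTranspose, mul_assoc]
  have hG : (A * F)ᴴ * (A * F) = diagonal (d 0) := by
    rw [conjTranspose_mul, mul_assoc, ← mul_assoc Aᴴ, ← hS, hdS, ← mul_assoc, hF.2, one_mul]
  have hs : ∀ t, ∃ p : ℝ, 0 < p ∧ (p : ℂ) * p = d 0 t := by
    intro t
    have e0 : d 0 t = ((∑ s, Complex.normSq ((A * F) s t) : ℝ) : ℂ) := by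
      have := congrFun (congrFun hG t) t
      rw [diagonal_apply_eq] at this
      rw [← this, Matrix.mul_apply]
      push_cast
      refine Finset.sum_congr rfl fun s _ => ?_
      rw [conjTranspose_apply]; exact (Complex.normSq_eq_conj_mul_self).symm
    have hnn : 0 ≤ ∑ s, Complex.normSq ((A * F) s t) :=
      Finset.sum_nonneg fun s _ => Complex.normSq_nonneg _
    have hne : d 0 t ≠ 0 := by
      have hinv : diagonal (d 0) * (Fᴴ * Q * F) = 1 := by
        have : F * diagonal (d 0) * (Fᴴ * Q * F) = F := by
          rw [← hdS]
          calc S * F * (Fᴴ * Q * F) = S * (F * Fᴴ) * Q * F := by simp only [mul_assoc]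
            _ = F := by rw [hF.1, mul_one, hSQ, one_mul]
        have := congrArg (Fᴴ * ·) this
        simpa [← mul_assoc, hF.2] using this
      have := congrFun (congrFun hinv t) t
      rw [diagonal_mul, one_apply_eq] at this
      exact left_ne_zero_of_mul_eq_one this
    rw [e0] at hne ⊢
    have hpos : 0 < ∑ s, Complex.normSq ((A * F) s t) :=
      lt_of_le_of_ne hnn fun h => hne (by rw [← h]; simp)
    exact ⟨Real.sqrt _, Real.sqrt_pos.mpr hpos, by
      rw [← Complex.ofReal_mul, Real.mul_self_sqrt hnn]⟩
  choose p hp hpp using hs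
  have hp0 : ∀ t, (p t : ℂ) ≠ 0 := fun t => by exact_mod_cast (hp t).ne'
  let E := A * F * diagonal (fun t => ((p t)⁻¹ : ℂ))
  have hE2 : Eᴴ * E = 1 := by
    have : Eᴴ * E = diagonal (star fun t => ((p t)⁻¹ : ℂ)) * ((A * F)ᴴ * (A * F)) *
        diagonal (fun t => ((p t)⁻¹ : ℂ)) := by
      simp only [E]
      rw [conjTranspose_mul, diagonal_conjTranspose]
      simp only [mul_assoc]
    rw [this, hG, diagonal_mul_diagonal, diagonal_mul_diagonal, ← diagonal_one]
    congr 1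
    ext t
    simp only [Pi.star_apply, star_inv₀, ← hpp]
    have : star (p t : ℂ) = p t := Complex.conj_ofReal _
    rw [this]
    field_simp [hp0 t]
  have hE : IsUnitary E := ⟨mul_eq_one_comm.mp hE2, hE2⟩
  have hAF : A * F = E * diagonal (fun t => (p t : ℂ)) := by
    simp only [E]
    rw [mul_assoc (A * F), diagonal_mul_diagonal]
    have : (fun t => ((p t)⁻¹ : ℂ) * p t) = fun _ => 1 := by
      ext t; exact inv_mul_cancel₀ (hp0 t)
    rw [this, diagonal_one, mul_one]
  have key : ∀ X x, X = F * diagonal x * Fᴴ →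
      A * X = E * diagonal (fun t => (p t : ℂ) * x t) * Fᴴ := by
    intro X x h
    rw [h, ← mul_assoc, ← mul_assoc, hAF, mul_assoc E, diagonal_mul_diagonal]
  refine ⟨E, F, fun t => (p t : ℂ) * 1, fun t => (p t : ℂ) * d 1 t,
    fun t => (p t : ℂ) * (-(d 2 t * star (d 1 t))), fun t => (p t : ℂ) * d 2 t, hE, hF, ?_, key _ _ eN, key _ (fun t => -(d 2 t * star (d 1 t))) ?_,
    key _ _ eL⟩
  · have := key 1 1 (by
      have : diagonal (1 : Fin k → ℂ) = 1 := diagonal_one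
      rw [this, mul_one, hF.1])
    rw [mul_one] at this
    exact this
  · have e2 : diagonal (fun t => -(d 2 t * star (d 1 t))) = - (diagonal (d 2) * diagonal (star (d 1))) := by
      rw [diagonal_mul_diagonal, diagonal_neg]; rfl
    rw [hK, eN', e2]
    conv_lhs => rw [eL]
    have : F * diagonal (d 2) * Fᴴ * (F * diagonal (star (d 1)) * Fᴴ)
      = F * diagonal (d 2) * (Fᴴ * F) * (diagonal (star (d 1)) * Fᴴ) := by simp only [mul_assoc]
    rw [this, hF.2]
    noncomm_ring

lemma exists_rot {k : ℕ} (A B : Matrix (Fin k) (Fin k) ℂ)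
    (h1 : Aᴴ * A + Bᴴ * B = 1) (h4 : A * Aᴴ + B * Bᴴ = 1) :
    ∃ c s : ℂ, star c = c ∧ star s = s ∧ c * c + s * s = 1 ∧
      IsUnit (c • A + s • B).det := by
  have hfin : {x : ℝ | ((Aᴴ * A).charpoly.eval (x : ℂ)) = 0}.Finite := by
    have h0 : (Aᴴ * A).charpoly ≠ 0 := (charpoly_monic _).ne_zero
    have := Polynomial.finite_setOfPred_isRoot h0
    exact this.preimage (Complex.ofReal_injective.injOn)
  obtain ⟨x, hx, hxn⟩ := (Set.Ioo_infinite (zero_lt_one (α := ℝ))).exists_notMem_finite hfin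
  have hx0 := hx.1
  have hx1 := hx.2
  refine ⟨(Real.sqrt (1 - x) : ℂ), (Real.sqrt x : ℂ), Complex.conj_ofReal _,
    Complex.conj_ofReal _, ?_, ?_⟩
  · rw [← Complex.ofReal_mul, ← Complex.ofReal_mul, Real.mul_self_sqrt (by linarith),
      Real.mul_self_sqrt (by linarith)]
    push_cast; ring
  obtain ⟨c, hc⟩ : ∃ c : ℂ, c = (Real.sqrt (1 - x) : ℂ) := ⟨_, rfl⟩
  obtain ⟨s, hs⟩ : ∃ s : ℂ, s = (Real.sqrt x : ℂ) := ⟨_, rfl⟩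
  rw [← hc, ← hs]
  have hcs : star c = c := by rw [hc]; exact Complex.conj_ofReal _
  have hss : star s = s := by rw [hs]; exact Complex.conj_ofReal _
  have hcc : c * c = 1 - x := by
    rw [hc, ← Complex.ofReal_mul, Real.mul_self_sqrt (by linarith)]; push_cast; rfl
  have hs2 : s * s = x := by
    rw [hs, ← Complex.ofReal_mul, Real.mul_self_sqrt (by linarith)]
  rw [isUnit_iff_ne_zero]
  intro hdet
  obtain ⟨v, hv, hMv⟩ := exists_mulVec_eq_zero_iff.mpr hdet
  set M := c • A + s • B with hM
  have hMh : Mᴴ = c • Aᴴ + s • Bᴴ := by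
    rw [hM]; simp only [conjTranspose_add, conjTranspose_smul, hcs, hss]
  have eB : Bᴴ * B = 1 - Aᴴ * A := by rw [← h1]; abel
  have eB' : B * Bᴴ = 1 - A * Aᴴ := by rw [← h4]; abel
  have hBS : B * (Aᴴ * A) = A * Aᴴ * B := by
    have e1 : Aᴴ * A = 1 - Bᴴ * B := by rw [eB]; abel
    have e2 : A * Aᴴ = 1 - B * Bᴴ := by rw [eB']; abel
    rw [e1, e2]; noncomm_ring
  have hkey : Aᴴ * M * (Mᴴ * A) = Aᴴ * A * (Mᴴ * M) := by
    have x1 : Aᴴ * B * (Bᴴ * A) = Aᴴ * A * (Bᴴ * B) := by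
      rw [eB]
      calc Aᴴ * B * (Bᴴ * A) = Aᴴ * (B * Bᴴ) * A := by simp only [mul_assoc]
        _ = _ := by rw [eB']; noncomm_ring
    have x2 : Aᴴ * B * (Aᴴ * A) = Aᴴ * A * (Aᴴ * B) := by
      rw [mul_assoc, hBS]; simp only [mul_assoc]
    have l : Aᴴ * M * (Mᴴ * A) = (c * c) • (Aᴴ * A * (Aᴴ * A)) + (c * s) • (Aᴴ * A * (Bᴴ * A))
        + (s * c) • (Aᴴ * B * (Aᴴ * A)) + (s * s) • (Aᴴ * B * (Bᴴ * A)) := by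
      rw [hMh, hM]
      simp only [mul_add, add_mul, smul_mul_assoc, mul_smul_comm, smul_add, smul_smul]
      module
    have r : Aᴴ * A * (Mᴴ * M) = (c * c) • (Aᴴ * A * (Aᴴ * A)) + (c * s) • (Aᴴ * A * (Bᴴ * A))
        + (s * c) • (Aᴴ * A * (Aᴴ * B)) + (s * s) • (Aᴴ * A * (Bᴴ * B)) := by
      rw [hMh, hM]
      simp only [mul_add, add_mul, smul_mul_assoc, mul_smul_comm, smul_add, smul_smul]
      module
    rw [l, r, x1, x2]
  have hw : (Mᴴ * A) *ᵥ v = 0 := by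
    have e : (Mᴴ * A)ᴴ * (Mᴴ * A) = Aᴴ * A * (Mᴴ * M) := by rw [← hkey]; simp
    have : ((Mᴴ * A)ᴴ * (Mᴴ * A)) *ᵥ v = 0 := by
      rw [e, ← mul_assoc, ← mulVec_mulVec, hMv, mulVec_zero]
    exact (conjTranspose_mul_self_mulVec_eq_zero _ _).mp this
  have hw2 : (Bᴴ * M) *ᵥ v = 0 := by rw [← mulVec_mulVec, hMv, mulVec_zero]
  have e1 : Mᴴ * A = c • (Aᴴ * A) + s • (Bᴴ * A) := by
    rw [hMh]; simp only [add_mul, smul_mul_assoc]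
  have e2 : Bᴴ * M = c • (Bᴴ * A) + s • (1 - Aᴴ * A) := by
    rw [hM, ← eB]; simp only [mul_add, mul_smul_comm]
  have e3 : (x : ℂ) • (1 : Matrix (Fin k) (Fin k) ℂ) - Aᴴ * A = s • (Bᴴ * M) - c • (Mᴴ * A) := by
    rw [e1, e2]
    have : (s • (c • (Bᴴ * A) + s • (1 - Aᴴ * A)) - c • (c • (Aᴴ * A) + s • (Bᴴ * A)))
      = (s * s) • (1 : Matrix (Fin k) (Fin k) ℂ) - (s * s + c * c) • (Aᴴ * A) := by module
    rw [this, hs2, hcc]; module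
  apply hxn
  show (Aᴴ * A).charpoly.eval (x : ℂ) = 0
  rw [eval_charpoly]
  apply exists_mulVec_eq_zero_iff.mp
  refine ⟨v, hv, ?_⟩
  have : scalar (Fin k) (x : ℂ) = (x : ℂ) • (1 : Matrix (Fin k) (Fin k) ℂ) := by
    rw [scalar_apply, smul_one_eq_diagonal]
  rw [this, e3, sub_mulVec, smul_mulVec, smul_mulVec, hw, hw2]
  simp

lemma rot_id {V : Type*} [AddCommGroup V] [Module ℂ V] (c s : ℂ) (h : c * c + s * s = 1)
    (x y : V) : x = c • (c • x + s • y) - s • (-s • x + c • y) := by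
  have : c • (c • x + s • y) - s • (-s • x + c • y) = (c * c + s * s) • x := by module
  rw [this, h, one_smul]

lemma rot_id2 {V : Type*} [AddCommGroup V] [Module ℂ V] (c s : ℂ) (h : c * c + s * s = 1)
    (x y : V) : y = s • (c • x + s • y) + c • (-s • x + c • y) := by
  have : s • (c • x + s • y) + c • (-s • x + c • y) = (c * c + s * s) • y := by module
  rw [this, h, one_smul]

lemma core2 {k : ℕ} (A B C D : Matrix (Fin k) (Fin k) ℂ)
    (h1 : Aᴴ * A + Bᴴ * B = 1) (h3 : Cᴴ * A + Dᴴ * B = 0)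
    (h4 : A * Aᴴ + B * Bᴴ = 1) (h5 : A * Cᴴ + B * Dᴴ = 0)
    (h7 : Aᴴ * A + Cᴴ * C = 1) (h8 : Bᴴ * B + Dᴴ * D = 1)
    (h9 : Aᴴ * B + Cᴴ * D = 0) (h9' : Bᴴ * A + Dᴴ * C = 0)
    (h10 : A * Aᴴ + C * Cᴴ = 1) (h11 : B * Bᴴ + D * Dᴴ = 1)
    (h12 : B * Aᴴ + D * Cᴴ = 0) (h12' : A * Bᴴ + C * Dᴴ = 0) :
    ∃ (E F : Matrix (Fin k) (Fin k) ℂ) (a b c d : Fin k → ℂ), IsUnitary E ∧ IsUnitary F ∧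
      A = E * diagonal a * Fᴴ ∧ B = E * diagonal b * Fᴴ ∧
      C = E * diagonal c * Fᴴ ∧ D = E * diagonal d * Fᴴ := by
  obtain ⟨c, s, hc, hs, hcs, hu⟩ := exists_rot A B h1 h4
  have hs' : star (-s) = -s := by rw [star_neg, hs]
  obtain ⟨E, F, a', b', c', d', hE, hF, ha, hb, hc', hd⟩ := core (c • A + s • B)
    (-s • A + c • B) (c • C + s • D) (-s • C + c • D) hu
    (by
      simp only [conjTranspose_add, conjTranspose_smul, hc, hs, hs']
      trans (c * c + s * s) • (Aᴴ * A + Bᴴ * B)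
      · simp only [mul_add, add_mul, smul_mul_assoc, mul_smul_comm]; module
      · rw [hcs, h1, one_smul])
    (by
      simp only [conjTranspose_add, conjTranspose_smul, hc, hs, hs']
      trans (c * c + s * s) • (Cᴴ * A + Dᴴ * B)
      · simp only [mul_add, add_mul, smul_mul_assoc, mul_smul_comm]; module
      · rw [hcs, h3, one_smul])
    (by
      simp only [conjTranspose_add, conjTranspose_smul, hc, hs, hs']
      trans (c * c + s * s) • (A * Aᴴ + B * Bᴴ)
      · simp only [mul_add, add_mul, smul_mul_assoc, mul_smul_comm]; module
      · rw [hcs, h4, one_smul])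
    (by
      simp only [conjTranspose_add, conjTranspose_smul, hc, hs, hs']
      trans (c * c + s * s) • (A * Cᴴ + B * Dᴴ)
      · simp only [mul_add, add_mul, smul_mul_assoc, mul_smul_comm]; module
      · rw [hcs, h5, one_smul])
    (by
      simp only [conjTranspose_add, conjTranspose_smul, hc, hs, hs']
      trans (c * c) • (Bᴴ * B + Dᴴ * D) + (s * s) • (Aᴴ * A + Cᴴ * C)
        - (c * s) • (Aᴴ * B + Cᴴ * D) - (c * s) • (Bᴴ * A + Dᴴ * C)
      · simp only [mul_add, add_mul, smul_mul_assoc, mul_smul_comm]; module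
      · rw [h7, h8, h9, h9', ← add_smul, hcs]; simp)
    (by
      simp only [conjTranspose_add, conjTranspose_smul, hc, hs, hs']
      trans (c * c) • (B * Bᴴ + D * Dᴴ) + (s * s) • (A * Aᴴ + C * Cᴴ)
        - (c * s) • (B * Aᴴ + D * Cᴴ) - (c * s) • (A * Bᴴ + C * Dᴴ)
      · simp only [mul_add, add_mul, smul_mul_assoc, mul_smul_comm]; module
      · rw [h10, h11, h12, h12', ← add_smul, hcs]; simp)
  have k1 : ∀ (u w : ℂ) (x y : Fin k → ℂ), u • (E * diagonal x * Fᴴ) + w • (E * diagonal y * Fᴴ)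
      = E * diagonal (u • x + w • y) * Fᴴ := by
    intro u w x y
    have e : diagonal (u • x + w • y) = u • diagonal x + w • diagonal y := by
      rw [← diagonal_smul, ← diagonal_smul, diagonal_add]; rfl
    rw [e]
    simp only [mul_add, add_mul, smul_mul_assoc, mul_smul_comm]
  have k2 : ∀ (u w : ℂ) (x y : Fin k → ℂ), u • (E * diagonal x * Fᴴ) - w • (E * diagonal y * Fᴴ)
      = E * diagonal (u • x - w • y) * Fᴴ := by
    intro u w x y
    have e : diagonal (u • x - w • y) = u • diagonal x - w • diagonal y := by
      rw [← diagonal_smul, ← diagonal_smul, diagonal_sub]; rfl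
    rw [e]
    simp only [mul_sub, sub_mul, smul_mul_assoc, mul_smul_comm]
  refine ⟨E, F, c • a' - s • b', s • a' + c • b', c • c' - s • d', s • c' + c • d', hE, hF, ?_, ?_, ?_, ?_⟩
  · rw [← k2, ← ha, ← hb]; exact rot_id c s hcs A B
  · rw [← k1, ← ha, ← hb]; exact rot_id2 c s hcs A B
  · rw [← k2, ← hc', ← hd]; exact rot_id c s hcs C D
  · rw [← k1, ← hc', ← hd]; exact rot_id2 c s hcs C D

/-- The `(i, j)` block of a bipartite matrix. -/
def blk {n k : ℕ} (U : Matrix (Fin n × Fin k) (Fin n × Fin k) ℂ) (i j : Fin n) :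
    Matrix (Fin k) (Fin k) ℂ := Matrix.of fun s t => U (i, s) (j, t)

lemma blk_mul {n k : ℕ} (U V : Matrix (Fin n × Fin k) (Fin n × Fin k) ℂ) (i j : Fin n) :
    blk (U * V) i j = ∑ l, blk U i l * blk V l j := by
  ext s t
  simp [blk, Matrix.mul_apply, Matrix.sum_apply, Fintype.sum_prod_type]

lemma blk_conj {n k : ℕ} (U : Matrix (Fin n × Fin k) (Fin n × Fin k) ℂ) (i j : Fin n) :
    blk Uᴴ i j = (blk U j i)ᴴ := by
  ext s t
  simp [blk]

lemma blk_one {n k : ℕ} (i j : Fin n) :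
    blk (1 : Matrix (Fin n × Fin k) (Fin n × Fin k) ℂ) i j = if i = j then 1 else 0 := by
  ext s t
  by_cases h : i = j <;> simp [blk, Matrix.one_apply, h]

lemma blk_kron {n k : ℕ} (β : Matrix (Fin k) (Fin k) ℂ) (i j : Fin n) :
    blk ((1 : Matrix (Fin n) (Fin n) ℂ) ⊗ₖ β) i j = if i = j then β else 0 := by
  ext s t
  by_cases h : i = j <;> simp [blk, Matrix.one_apply, h]

lemma channel_apply {n k : ℕ} (U : Matrix (Fin n × Fin k) (Fin n × Fin k) ℂ)
    (β : Matrix (Fin k) (Fin k) ℂ) (i i' : Fin n) :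
    channel U β 1 i i' = ((∑ j, (blk U i' j)ᴴ * blk U i j) * β).trace := by
  have : channel U β 1 i i' = (blk (U * ((1 : Matrix (Fin n) (Fin n) ℂ) ⊗ₖ β) * Uᴴ) i i').trace :=
    rfl
  rw [this, blk_mul, trace_sum, Finset.sum_mul, trace_sum]
  refine Finset.sum_congr rfl fun j _ => ?_
  rw [blk_mul, blk_conj]
  simp only [blk_kron, mul_ite, mul_zero, Finset.sum_ite_eq', Finset.sum_ite_eq,
    Finset.mem_univ, if_true]
  rw [trace_mul_comm, mul_assoc]

lemma eq_zero_of_quad {k : ℕ} (Y : Matrix (Fin k) (Fin k) ℂ)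
    (h : ∀ v : Fin k → ℂ, star v ⬝ᵥ (Y *ᵥ v) = 0) : Y = 0 := by
  have h2 : toEuclideanLin Y = 0 := by
    rw [← inner_map_self_eq_zero]
    intro x
    have := h x.ofLp
    rw [← inner_conj_symm, EuclideanSpace.inner_eq_star_dotProduct, dotProduct_comm]
    have e : (toEuclideanLin Y x).ofLp = Y *ᵥ x.ofLp := rfl
    rw [e, this, map_zero]
  exact toEuclideanLin.map_eq_zero_iff.mp h2

lemma unital_iff {n k : ℕ} (U : Matrix (Fin n × Fin k) (Fin n × Fin k) ℂ) :
    (∀ β : Matrix (Fin k) (Fin k) ℂ, IsDensity β → channel U β 1 = 1) ↔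
      ∀ i i', ∑ j, (blk U i' j)ᴴ * blk U i j = if i = i' then 1 else 0 := by
  constructor
  · intro h i i'
    rw [← sub_eq_zero]
    set X := ∑ j, (blk U i' j)ᴴ * blk U i j with hX
    have hX2 : ∀ β : Matrix (Fin k) (Fin k) ℂ, IsDensity β →
        ((X - if i = i' then 1 else 0) * β).trace = 0 := by
      intro β hβ
      have := congrFun (congrFun (h β hβ) i) i'
      rw [channel_apply, ← hX, Matrix.one_apply] at this
      rw [sub_mul, trace_sub, this]
      by_cases hi : i = i' <;> simp [hi, hβ.2]
    apply eq_zero_of_quad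
    intro v
    by_cases hv : v = 0
    · simp [hv]
    have hpos : 0 < star v ⬝ᵥ v := dotProduct_star_self_pos_iff.mpr hv
    have hne : star v ⬝ᵥ v ≠ 0 := hpos.ne'
    have hd : IsDensity ((star v ⬝ᵥ v)⁻¹ • vecMulVec v (star v)) := by
      refine ⟨(posSemidef_vecMulVec_self_star v).smul (inv_nonneg.mpr hpos.le), ?_⟩
      rw [trace_smul, trace_vecMulVec, dotProduct_comm v, smul_eq_mul, inv_mul_cancel₀ hne]
    have := hX2 _ hd
    rw [mul_smul_comm, trace_smul, smul_eq_mul, mul_vecMulVec, trace_vecMulVec] at this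
    rw [dotProduct_comm]
    exact (mul_eq_zero.mp this).resolve_left (inv_ne_zero hne)
  · intro h β hβ
    ext i i'
    rw [channel_apply, h, Matrix.one_apply]
    by_cases hi : i = i' <;> simp [hi, hβ.2]

lemma blk_sum {n k : ℕ} (E F : Matrix (Fin k) (Fin k) ℂ)
    (Us : Fin k → Matrix (Fin n) (Fin n) ℂ) (i j : Fin n) :
    blk (∑ t, Us t ⊗ₖ vecMulVec (fun s => E s t) (star fun s => F s t)) i j =
      E * diagonal (fun t => Us t i j) * Fᴴ := by
  ext s s'
  rw [Matrix.mul_apply]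
  simp only [blk, Matrix.of_apply, Matrix.sum_apply, kroneckerMap_apply, vecMulVec_apply,
    mul_diagonal, conjTranspose_apply, Pi.star_apply]
  refine Finset.sum_congr rfl fun t _ => ?_
  ring

lemma blk_ext {n k : ℕ} {U V : Matrix (Fin n × Fin k) (Fin n × Fin k) ℂ}
    (h : ∀ i j, blk U i j = blk V i j) : U = V := by
  ext ⟨i, s⟩ ⟨j, t⟩
  exact congrFun (congrFun (h i j) s) t

lemma onb_iff {k : ℕ} (E : Matrix (Fin k) (Fin k) ℂ) :
    ONB (fun t s => E s t) ↔ Eᴴ * E = 1 := by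
  constructor
  · intro h
    ext i j
    rw [Matrix.mul_apply, Matrix.one_apply, ← h i j]
    rfl
  · intro h i j
    rw [← Matrix.one_apply, ← h, Matrix.mul_apply]
    rfl

lemma diag_gram {n k : ℕ} (E F : Matrix (Fin k) (Fin k) ℂ) (hF : Fᴴ * F = 1)
    (Us : Fin k → Matrix (Fin n) (Fin n) ℂ) (i i' : Fin n) :
    ∑ j, (E * diagonal (fun t => Us t i j) * Fᴴ) * (E * diagonal (fun t => Us t i' j) * Fᴴ)ᴴ
      = E * diagonal (fun t => (Us t * (Us t)ᴴ) i i') * Eᴴ := by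
  have e : diagonal (fun t => (Us t * (Us t)ᴴ) i i') = ∑ j, diagonal (fun t => Us t i j) *
      diagonal (star fun t => Us t i' j) := by
    ext s t
    simp only [Matrix.sum_apply, diagonal_mul_diagonal, diagonal_apply]
    by_cases h : s = t <;> simp [h, Matrix.mul_apply]
  rw [e, Finset.mul_sum, Finset.sum_mul]
  refine Finset.sum_congr rfl fun j _ => ?_
  rw [conjTranspose_mul, conjTranspose_mul, diagonal_conjTranspose, conjTranspose_conjTranspose]
  calc _ = E * diagonal (fun t => Us t i j) * (Fᴴ * F) * (diagonal (star fun t => Us t i' j) * Eᴴ) := by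
        simp only [mul_assoc]
    _ = _ := by rw [hF]; simp only [mul_assoc, mul_one]

lemma diag_gram' {n k : ℕ} (E F : Matrix (Fin k) (Fin k) ℂ) (hE : Eᴴ * E = 1)
    (Us : Fin k → Matrix (Fin n) (Fin n) ℂ) (i i' : Fin n) :
    ∑ j, (E * diagonal (fun t => Us t i' j) * Fᴴ)ᴴ * (E * diagonal (fun t => Us t i j) * Fᴴ)
      = F * diagonal (fun t => (Us t * (Us t)ᴴ) i i') * Fᴴ := by
  have e : diagonal (fun t => (Us t * (Us t)ᴴ) i i') = ∑ j, diagonal (star fun t => Us t i' j) *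
      diagonal (fun t => Us t i j) := by
    ext s t
    simp only [Matrix.sum_apply, diagonal_mul_diagonal, diagonal_apply]
    by_cases h : s = t <;> simp [h, Matrix.mul_apply, mul_comm]
  rw [e, Finset.mul_sum, Finset.sum_mul]
  refine Finset.sum_congr rfl fun j _ => ?_
  rw [conjTranspose_mul, conjTranspose_mul, diagonal_conjTranspose, conjTranspose_conjTranspose]
  calc _ = F * diagonal (star fun t => Us t i' j) * (Eᴴ * E) * (diagonal (fun t => Us t i j) * Fᴴ) := by
        simp only [mul_assoc]
    _ = _ := by rw [hE]; simp only [mul_assoc, mul_one]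

/-- The partial transpose is unitary, hence the second family of relations. -/
lemma pt_rel {n k : ℕ} (U : Matrix (Fin n × Fin k) (Fin n × Fin k) ℂ)
    (h : ∀ i i', ∑ j, (blk U i' j)ᴴ * blk U i j = if i = i' then 1 else 0) (i i' : Fin n) :
    ∑ j, blk U j i * (blk U j i')ᴴ = if i = i' then 1 else 0 := by
  have hb : ∀ i j, blk (pt U) i j = (blk U i j)ᵀ := fun i j => rfl
  have h1 : pt U * (pt U)ᴴ = 1 := by
    apply blk_ext
    intro i i'
    rw [blk_mul, blk_one]
    have := congrArg transpose (h i i')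
    rw [transpose_sum] at this
    have e : ((if i = i' then 1 else 0 : Matrix (Fin k) (Fin k) ℂ))ᵀ = if i = i' then 1 else 0 := by
      split_ifs <;> simp
    rw [e] at this
    rw [← this]
    refine Finset.sum_congr rfl fun j _ => ?_
    rw [blk_conj, hb, hb, transpose_mul]; rfl
  have h2 : (pt U)ᴴ * pt U = 1 := mul_eq_one_comm.mp h1
  have h3 := congrArg (fun V => (blk V i' i)ᵀ) h2
  simp only [blk_mul, blk_one, transpose_sum, blk_conj, hb, transpose_mul, transpose_transpose] at h3
  have e : ((if i' = i then 1 else 0 : Matrix (Fin k) (Fin k) ℂ))ᵀ = if i = i' then 1 else 0 := by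
    by_cases hi : i = i'
    · simp [hi]
    · simp [hi, Ne.symm hi]
  rw [e] at h3
  rw [← h3]
  rfl

/-- for `n = 2`, `𝒰^A_{block-diag} = 𝒰_{unital}`: a bipartite unitary
on `ℂ² ⊗ ℂ^k` yields unital channels for all ancilla states iff it is block-diagonal
with respect to the first factor. -/
theorem stmt18 (k : ℕ) (hk : 0 < k)
    (U : Matrix (Fin 2 × Fin k) (Fin 2 × Fin k) ℂ) (hU : IsUnitary U) :
    (∀ β : Matrix (Fin k) (Fin k) ℂ, IsDensity β → channel U β 1 = 1)
    ↔ memUA U := by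
  have r1 : ∀ i i', ∑ j, blk U i j * (blk U i' j)ᴴ = if i = i' then 1 else 0 := by
    intro i i'
    rw [← blk_one, ← hU.1, blk_mul]
    simp only [blk_conj]
  have r2 : ∀ i i', ∑ j, (blk U j i)ᴴ * blk U j i' = if i = i' then 1 else 0 := by
    intro i i'
    rw [← blk_one, ← hU.2, blk_mul]
    simp only [blk_conj]
  rw [unital_iff]
  constructor
  · intro h
    have h' := pt_rel U h
    simp only [Fin.sum_univ_two] at h h' 
    have q1 := r1
    simp only [Fin.sum_univ_two] at q1 r2
    obtain ⟨E, F, a, b, c, d, hE, hF, hA, hB, hC, hD⟩ := core2 (blk U 0 0) (blk U 0 1)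
      (blk U 1 0) (blk U 1 1) (by simpa using h 0 0) (by simpa using h 0 1)
      (by simpa using q1 0 0) (by simpa using q1 0 1) (by simpa using r2 0 0)
      (by simpa using r2 1 1) (by simpa using r2 0 1) (by simpa using r2 1 0)
      (by simpa using h' 0 0) (by simpa using h' 1 1) (by simpa using h' 1 0)
      (by simpa using h' 0 1)
    let Us : Fin k → Matrix (Fin 2) (Fin 2) ℂ := fun t => !![a t, b t; c t, d t]
    have hb : ∀ i j, blk U i j = E * diagonal (fun t => Us t i j) * Fᴴ := by
      intro i j
      fin_cases i <;> fin_cases j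
      · exact hA
      · exact hB
      · exact hC
      · exact hD
    refine ⟨Us, fun t s => E s t, fun t s => F s t, ?_, (onb_iff E).mpr hE.2, (onb_iff F).mpr hF.2,
      ?_⟩
    · intro t
      have : Us t * (Us t)ᴴ = 1 := by
        ext i i'
        have e := r1 i i'
        simp only [hb] at e
        rw [diag_gram E F hF.2] at e
        have e2 := congrArg (fun Z => Eᴴ * Z * E) e
        have e3 : Eᴴ * (E * diagonal (fun t => (Us t * (Us t)ᴴ) i i') * Eᴴ) * E =
            diagonal (fun t => (Us t * (Us t)ᴴ) i i') := by
          calc _ = (Eᴴ * E) * diagonal (fun t => (Us t * (Us t)ᴴ) i i') * (Eᴴ * E) := by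
                simp only [mul_assoc]
            _ = _ := by rw [hE.2, one_mul, mul_one]
        simp only [e3] at e2
        have e4 := congrFun (congrFun e2 t) t
        rw [diagonal_apply_eq] at e4
        rw [e4, Matrix.one_apply]
        by_cases hi : i = i' <;> simp [hi, hE.2]
      exact ⟨this, mul_eq_one_comm.mp this⟩
    · apply blk_ext
      intro i j
      rw [blk_sum, hb]
  · rintro ⟨Us, e, f, hUs, he, hf, hUe⟩ i i'
    obtain ⟨E, rfl⟩ : ∃ E : Matrix (Fin k) (Fin k) ℂ, e = fun t s => E s t :=
      ⟨Matrix.of fun s t => e t s, rfl⟩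
    obtain ⟨F, rfl⟩ : ∃ F : Matrix (Fin k) (Fin k) ℂ, f = fun t s => F s t :=
      ⟨Matrix.of fun s t => f t s, rfl⟩
    rw [onb_iff] at he hf
    simp only [hUe, blk_sum]
    rw [diag_gram' E F he]
    simp only [(hUs _).1, Matrix.one_apply]
    have hf' : F * Fᴴ = 1 := mul_eq_one_comm.mp hf
    by_cases hi : i = i' <;> simp [hi, hf']

end BipartiteUnitary
end
end

section
/- Let X ∈ M_n(ℂ) ⊗ M_k(ℂ). The following conditions are equivalent: (1) X has a block-diagonal singular value decomposition, i.e. X = Σ_{i=1}^p X_i ⊗ R_i for some matrices X_i ∈ M_n(ℂ) and partial isometries R_i ∈ M_k(ℂ) whose initial projections R_i*R_i are pairwise orthogonal and whose final projections R_iR_i* are pairwise orthogonal; (2) the family {X_A X_B* : A, B ∈ M_n(ℂ)} consists of normal, pairwise commuting operators, and the family {X_A* X_B : A, B ∈ M_n(ℂ)} consists of normal, pairwise commuting operators, where X_A := [Tr ⊗ id](X · (A ⊗ I_k)); (3) for some (equivalently, any) orthonormal basis {E_α}_{α=1}^{n²} of M_n(ℂ) with respect to the Hilbert–Schmidt inner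 product, writing X_α := X_{E_α*}, the family {X_α X_β*}_{α,β=1}^{n²} consists of normal, pairwise commuting operators and the family {X_α* X_β}_{α,β=1}^{n²} consists of normal, pairwise commuting operators. -/
open Matrix Kronecker ComplexOrder

noncomputable section

namespace BipartiteUnitary

/-- The operator `X_A = [Tr ⊗ id](X · (A ⊗ I_k))`. -/
def XA {n k : ℕ} (X : Matrix (Fin n × Fin k) (Fin n × Fin k) ℂ)
    (A : Matrix (Fin n) (Fin n) ℂ) : Matrix (Fin k) (Fin k) ℂ :=
  trA (X * (A ⊗ₖ (1 : Matrix (Fin k) (Fin k) ℂ)))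

/-- A family `Y` such that all `Y_a Y_b*` are normal and pairwise commute, and all
`Y_a* Y_b` are normal and pairwise commute. -/
def NormalCommFam {ι : Type*} {k : ℕ} (Y : ι → Matrix (Fin k) (Fin k) ℂ) : Prop :=
  (∀ a b, IsStarNormal (Y a * (Y b)ᴴ)) ∧
  (∀ a b c d, Commute (Y a * (Y b)ᴴ) (Y c * (Y d)ᴴ)) ∧
  (∀ a b, IsStarNormal ((Y a)ᴴ * Y b)) ∧
  (∀ a b c d, Commute ((Y a)ᴴ * Y b) ((Y c)ᴴ * Y d))

/-- Block-diagonal singular value decomposition: `X = ∑ X_i ⊗ R_i` with partial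
isometries `R_i` having pairwise orthogonal initial and final projections. -/
def HasBlockSVD {n k : ℕ} (X : Matrix (Fin n × Fin k) (Fin n × Fin k) ℂ) : Prop :=
  ∃ (p : ℕ) (Xs : Fin p → Matrix (Fin n) (Fin n) ℂ)
    (Rs : Fin p → Matrix (Fin k) (Fin k) ℂ),
    (∀ i, IsPartialIso (Rs i)) ∧
    (∀ i j, i ≠ j → ((Rs i)ᴴ * Rs i) * ((Rs j)ᴴ * Rs j) = 0) ∧
    (∀ i j, i ≠ j → (Rs i * (Rs i)ᴴ) * (Rs j * (Rs j)ᴴ) = 0) ∧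
    X = ∑ i, Xs i ⊗ₖ Rs i

/-- An orthonormal basis of `M_n(ℂ)` for the Hilbert–Schmidt inner product. -/
def HSONB {n : ℕ} (E : Fin (n ^ 2) → Matrix (Fin n) (Fin n) ℂ) : Prop :=
  ∀ a b, ((E a)ᴴ * E b).trace = if a = b then (1 : ℂ) else 0

lemma simDiag {ι : Type*} {k : ℕ} (M : ι → Matrix (Fin k) (Fin k) ℂ)
    (hM : ∀ i, (M i).IsHermitian) (hc : ∀ i j, Commute (M i) (M j)) :
    ∃ e : Fin k → Fin k → ℂ, ONB e ∧ ∀ i j, ∃ c : ℂ, M i *ᵥ e j = c • e j := by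
  classical
  let T : ι → Module.End ℂ (EuclideanSpace ℂ (Fin k)) := fun i => Matrix.toEuclideanLin (M i)
  have hT : ∀ i, (T i).IsSymmetric := fun i => Matrix.isSymmetric_toEuclideanLin_iff.mpr (hM i)
  have hcT : Pairwise (Function.onFun Commute T) := by
    intro i j _
    have h := (hc i j).eq
    change T i * T j = T j * T i
    apply LinearMap.ext
    intro x
    apply (WithLp.linearEquiv 2 ℂ (Fin k → ℂ)).injective
    have := congrArg (fun N => N *ᵥ x.ofLp) h
    simpa [T, Matrix.mulVec_mulVec] using this
  let V : (ι → ℂ) → Submodule ℂ (EuclideanSpace ℂ (Fin k)) :=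
    fun α => ⨅ j, Module.End.eigenspace (T j) (α j)
  have hint : DirectSum.IsInternal V :=
    LinearMap.IsSymmetric.directSum_isInternal_of_pairwise_commute hT hcT
  have hort : OrthogonalFamily ℂ (fun α => V α) fun α => (V α).subtypeₗᵢ :=
    LinearMap.IsSymmetric.orthogonalFamily_iInf_eigenspaces hT
  have hint' := DirectSum.isInternal_ne_bot_iff.mpr hint
  have hort' : OrthogonalFamily ℂ (fun α : {α // V α ≠ ⊥} => V α)
      fun α => (V α).subtypeₗᵢ := hort.comp Subtype.val_injective
  have : Fintype {α // V α ≠ ⊥} :=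
    (DirectSum.IsInternal.submodule_iSupIndep hint).fintypeNeBotOfFiniteDimensional
  have hn : Module.finrank ℂ (EuclideanSpace ℂ (Fin k)) = k := by simp
  let b := hint'.subordinateOrthonormalBasis hn hort'
  refine ⟨fun j => (b j).ofLp, ?_, ?_⟩
  · intro i j
    have := orthonormal_iff_ite.mp b.orthonormal i j
    rw [← this, EuclideanSpace.inner_eq_star_dotProduct]
    simp [dotProduct, mul_comm]
  · intro i j
    have h1 := hint'.subordinateOrthonormalBasis_subordinate hn j hort'
    have h2 := (Submodule.mem_iInf _).mp h1 i
    rw [Module.End.mem_eigenspace_iff] at h2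
    exact ⟨_, congrArg WithLp.ofLp h2⟩

lemma ONB.complete {k : ℕ} {e : Fin k → Fin k → ℂ} (he : ONB e) :
    ∑ j, vecMulVec (e j) (star (e j)) = (1 : Matrix (Fin k) (Fin k) ℂ) := by
  have h : (Matrix.of fun i s => star (e i s)) * (Matrix.of fun s i => e i s) =
      (1 : Matrix (Fin k) (Fin k) ℂ) := by
    ext i j
    simpa [Matrix.mul_apply, Matrix.one_apply] using he i j
  rw [_root_.mul_eq_one_comm] at h
  rw [← h]
  ext s t
  simp [Matrix.sum_apply, Matrix.mul_apply, vecMulVec_apply]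

lemma dot_adj {k : ℕ} (M : Matrix (Fin k) (Fin k) ℂ) (v w : Fin k → ℂ) :
    star (Mᴴ *ᵥ v) ⬝ᵥ w = star v ⬝ᵥ (M *ᵥ w) := by
  rw [Matrix.star_mulVec, Matrix.conjTranspose_conjTranspose, Matrix.dotProduct_mulVec]

lemma diagLeft {ι : Type*} {k : ℕ} (Y : ι → Matrix (Fin k) (Fin k) ℂ)
    (h1 : ∀ a b c d, Commute (Y a * (Y b)ᴴ) (Y c * (Y d)ᴴ)) :
    ∃ e : Fin k → Fin k → ℂ, ONB e ∧
      ∀ j, ∃ l : ι → ι → ℂ, ∀ a b, (Y a * (Y b)ᴴ) *ᵥ e j = l a b • e j := by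
  obtain ⟨e, he, h⟩ := simDiag
    (fun t : (ι × ι) ⊕ (ι × ι) => Sum.elim
      (fun p => Y p.1 * (Y p.2)ᴴ + Y p.2 * (Y p.1)ᴴ)
      (fun p => Complex.I • (Y p.1 * (Y p.2)ᴴ - Y p.2 * (Y p.1)ᴴ)) t)
    (by
      rintro (p | p)
      · simp [Matrix.IsHermitian, add_comm]
      · simp [Matrix.IsHermitian, ← smul_neg])
    (by
      rintro (p | p) (q | q)
      · exact (((h1 _ _ _ _).add_left (h1 _ _ _ _)).add_right
          ((h1 _ _ _ _).add_left (h1 _ _ _ _)))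
      · exact ((((h1 _ _ _ _).add_left (h1 _ _ _ _)).sub_right
          ((h1 _ _ _ _).add_left (h1 _ _ _ _)))).smul_right _
      · exact ((((h1 _ _ _ _).sub_left (h1 _ _ _ _)).add_right
          ((h1 _ _ _ _).sub_left (h1 _ _ _ _)))).smul_left _
      · exact (((((h1 _ _ _ _).sub_left (h1 _ _ _ _)).sub_right
          ((h1 _ _ _ _).sub_left (h1 _ _ _ _)))).smul_left _).smul_right _)
  refine ⟨e, he, fun j => ?_⟩
  have : ∀ a b, ∃ l : ℂ, (Y a * (Y b)ᴴ) *ᵥ e j = l • e j := by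
    intro a b
    obtain ⟨c, hc⟩ := h (Sum.inl (a, b)) j
    obtain ⟨d, hd⟩ := h (Sum.inr (a, b)) j
    simp only [Sum.elim_inl, Sum.elim_inr] at hc hd
    refine ⟨(1/2) * c - (Complex.I / 2) * d, ?_⟩
    have : Y a * (Y b)ᴴ = (1/2 : ℂ) • (Y a * (Y b)ᴴ + Y b * (Y a)ᴴ)
        - (Complex.I / 2) • (Complex.I • (Y a * (Y b)ᴴ - Y b * (Y a)ᴴ)) := by
      ext s t
      simp only [Matrix.sub_apply, Matrix.add_apply, Matrix.smul_apply, smul_eq_mul]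
      linear_combination (1/2) * ((Y a * (Y b)ᴴ) s t - (Y b * (Y a)ᴴ) s t) * Complex.I_mul_I
    rw [this, Matrix.sub_mulVec, Matrix.smul_mulVec, Matrix.smul_mulVec, hc, hd]
    module
  choose l hl using this
  exact ⟨l, hl⟩

lemma unitVec {k : ℕ} (v : Fin k → ℂ) (hv : v ≠ 0) :
    ∃ r : ℂ, r ≠ 0 ∧ star (r • v) ⬝ᵥ (r • v) = 1 := by
  have h0 : 0 ≤ star v ⬝ᵥ v := dotProduct_star_self_nonneg v
  have hne : star v ⬝ᵥ v ≠ 0 := by simpa using hv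
  obtain ⟨x, hx⟩ : ∃ x : ℝ, star v ⬝ᵥ v = x := ⟨_, Complex.eq_re_of_ofReal_le (r := 0) (by simpa using h0)⟩
  rw [hx] at h0 hne
  have hx0 : 0 < x := lt_of_le_of_ne (by exact_mod_cast h0) (by
    rintro rfl; simp at hne)
  have hs := Real.sqrt_pos.mpr hx0
  refine ⟨((Real.sqrt x)⁻¹ : ℝ), by exact_mod_cast (inv_pos.mpr hs).ne', ?_⟩
  rw [star_smul, smul_dotProduct, dotProduct_smul, hx]
  simp only [RCLike.star_def, Complex.conj_ofReal, smul_eq_mul]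
  norm_cast
  have := Real.mul_self_sqrt hx0.le
  field_simp
  nlinarith

lemma rankOne {ι : Type*} {k : ℕ} (Y : ι → Matrix (Fin k) (Fin k) ℂ)
    (h2 : ∀ a b c d, Commute ((Y a)ᴴ * Y b) ((Y c)ᴴ * Y d))
    (e : Fin k → ℂ) (he : star e ⬝ᵥ e = 1) (l : ι → ι → ℂ)
    (hl : ∀ a b, (Y a * (Y b)ᴴ) *ᵥ e = l a b • e) :
    ∃ f : Fin k → ℂ, (f = 0 ∨ star f ⬝ᵥ f = 1) ∧
      (f = 0 ∨ ∃ a, ∃ r : ℂ, f = r • ((Y a)ᴴ *ᵥ e)) ∧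
      ∃ c : ι → ℂ, ∀ b, (Y b)ᴴ *ᵥ e = c b • f := by
  by_cases h0 : ∀ b, (Y b)ᴴ *ᵥ e = 0
  · exact ⟨0, Or.inl rfl, Or.inl rfl, 0, fun b => by simp [h0 b]⟩
  push Not at h0
  obtain ⟨a, ha⟩ := h0
  have hee : ∀ x y : ℂ, x • e = y • e → x = y := by
    intro x y h
    have := congrArg (fun v => star e ⬝ᵥ v) h
    simpa [he] using this
  have haa : l a a ≠ 0 := by
    intro h
    apply ha
    rw [← dotProduct_star_self_eq_zero, dot_adj, Matrix.mulVec_mulVec, hl, h]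
    simp
  have hrel : ∀ d f, l a a * l d f = l a f * l d a := by
    intro d f
    have h := (h2 a a a d).eq
    have h' := congrArg (fun N => (Y a * N * (Y f)ᴴ) *ᵥ e) h
    have e1 : Y a * ((Y a)ᴴ * Y a * ((Y a)ᴴ * Y d)) * (Y f)ᴴ =
      (Y a * (Y a)ᴴ) * ((Y a * (Y a)ᴴ) * (Y d * (Y f)ᴴ)) := by simp only [Matrix.mul_assoc]
    have e2 : Y a * ((Y a)ᴴ * Y d * ((Y a)ᴴ * Y a)) * (Y f)ᴴ =
      (Y a * (Y a)ᴴ) * ((Y d * (Y a)ᴴ) * (Y a * (Y f)ᴴ)) := by simp only [Matrix.mul_assoc]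
    simp only [e1, e2] at h'
    simp only [← Matrix.mulVec_mulVec _ _ (_ * _), hl, Matrix.mulVec_smul, smul_smul] at h'
    have := hee _ _ h'
    apply mul_left_cancel₀ haa
    linear_combination this
  have key : ∀ f, l a a • ((Y f)ᴴ *ᵥ e) = l a f • ((Y a)ᴴ *ᵥ e) := by
    intro f
    rw [← sub_eq_zero]
    set w := l a a • ((Y f)ᴴ *ᵥ e) - l a f • ((Y a)ᴴ *ᵥ e) with hw
    have hker : ∀ d, Y d *ᵥ w = 0 := by
      intro d
      rw [hw, Matrix.mulVec_sub, Matrix.mulVec_smul, Matrix.mulVec_smul, Matrix.mulVec_mulVec,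
        Matrix.mulVec_mulVec, hl, hl, smul_smul, smul_smul, hrel, sub_self]
    have : star w ⬝ᵥ w = 0 := by
      conv_lhs => rw [hw]
      rw [← hw, star_sub, star_smul, star_smul, sub_dotProduct, smul_dotProduct, smul_dotProduct,
        dot_adj, dot_adj, hker, hker]
      simp
    simpa using this
  obtain ⟨r, hr, hr1⟩ := unitVec _ ha
  refine ⟨r • ((Y a)ᴴ *ᵥ e), Or.inr hr1, Or.inr ⟨a, r, rfl⟩, fun b => (l a a)⁻¹ * l a b * r⁻¹, ?_⟩
  intro b
  rw [smul_smul, mul_assoc, inv_mul_cancel₀ hr, mul_one, ← smul_smul, ← key, smul_smul,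
    inv_mul_cancel₀ haa, one_smul]

lemma simSVD {ι : Type*} {k : ℕ} (Y : ι → Matrix (Fin k) (Fin k) ℂ) (h : NormalCommFam Y) :
    ∃ (e f : Fin k → Fin k → ℂ) (c : ι → Fin k → ℂ), ONB e ∧
      (∀ i, f i = 0 ∨ star (f i) ⬝ᵥ f i = 1) ∧ (∀ i j, i ≠ j → star (f i) ⬝ᵥ f j = 0) ∧
      ∀ b, Y b = ∑ j, c b j • vecMulVec (e j) (star (f j)) := by
  obtain ⟨-, h1, -, h2⟩ := h
  obtain ⟨e, he, hd⟩ := diagLeft Y h1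
  choose l hl using hd
  have he' : ∀ i j, star (e i) ⬝ᵥ e j = if i = j then (1 : ℂ) else 0 := he
  have := fun j => rankOne Y h2 (e j) (by rw [he', if_pos rfl]) (l j) (hl j)
  choose f hf hf' c hc using this
  refine ⟨e, f, fun b j => star (c j b), he, hf, ?_, ?_⟩
  · intro i j hij
    rcases hf' i with h | ⟨a, r, h⟩
    · simp [h]
    rcases hf' j with h' | ⟨a', r', h'⟩
    · simp [h']
    rw [h, h', star_smul, smul_dotProduct, dotProduct_smul, dot_adj, Matrix.mulVec_mulVec, hl,
      dotProduct_smul, he', if_neg hij]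
    simp
  · intro b
    conv_lhs => rw [← Matrix.one_mul (Y b), ← he.complete, Finset.sum_mul]
    refine Finset.sum_congr rfl fun j _ => ?_
    rw [Matrix.vecMulVec_mul]
    have : star (e j) ᵥ* Y b = star (c j b • f j) := by
      rw [← hc, Matrix.star_mulVec, Matrix.conjTranspose_conjTranspose]
    rw [this, star_smul, Matrix.vecMulVec_smul]

lemma XA_apply {n k : ℕ} (X : Matrix (Fin n × Fin k) (Fin n × Fin k) ℂ)
    (A : Matrix (Fin n) (Fin n) ℂ) (s t : Fin k) :
    XA X A s t = ∑ i, ∑ j, X (i, s) (j, t) * A j i := by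
  simp [XA, trA, Matrix.mul_apply, Fintype.sum_prod_type, Matrix.one_apply]

lemma XA_single {n k : ℕ} (X : Matrix (Fin n × Fin k) (Fin n × Fin k) ℂ)
    (i j : Fin n) (s t : Fin k) :
    XA X (Matrix.single j i 1) s t = X (i, s) (j, t) := by
  rw [XA_apply]
  simp [Matrix.single_apply, ite_and]

lemma XA_sum {n k : ℕ} (X : Matrix (Fin n × Fin k) (Fin n × Fin k) ℂ) {ι : Type*} (S : Finset ι)
    (c : ι → ℂ) (A : ι → Matrix (Fin n) (Fin n) ℂ) :
    XA X (∑ a ∈ S, c a • A a) = ∑ a ∈ S, c a • XA X (A a) := by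
  ext s t
  simp only [XA_apply, Matrix.sum_apply, Matrix.smul_apply, smul_eq_mul, Finset.mul_sum]
  rw [Finset.sum_comm]
  rw [Finset.sum_comm]
  conv_rhs => rw [Finset.sum_comm]
  refine Finset.sum_congr rfl fun i _ => ?_
  rw [Finset.sum_comm]
  refine Finset.sum_congr rfl fun j _ => Finset.sum_congr rfl fun a _ => ?_
  ring

lemma XA_kron {n k p : ℕ} (Xs : Fin p → Matrix (Fin n) (Fin n) ℂ)
    (Rs : Fin p → Matrix (Fin k) (Fin k) ℂ) (A : Matrix (Fin n) (Fin n) ℂ) :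
    XA (∑ i, Xs i ⊗ₖ Rs i) A = ∑ i, (Xs i * A).trace • Rs i := by
  ext s t
  simp only [XA_apply, Matrix.sum_apply, Matrix.smul_apply, smul_eq_mul, kroneckerMap_apply,
    Matrix.trace, Matrix.diag, Matrix.mul_apply, Finset.sum_mul]
  conv_rhs => rw [Finset.sum_comm]
  refine Finset.sum_congr rfl fun i _ => ?_
  conv_rhs => rw [Finset.sum_comm]
  refine Finset.sum_congr rfl fun j _ => Finset.sum_congr rfl fun a _ => ?_
  ring

lemma ncf_of {ι : Type*} {k : ℕ} {Y : ι → Matrix (Fin k) (Fin k) ℂ}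
    (h1 : ∀ a b c d, Commute (Y a * (Y b)ᴴ) (Y c * (Y d)ᴴ))
    (h2 : ∀ a b c d, Commute ((Y a)ᴴ * Y b) ((Y c)ᴴ * Y d)) : NormalCommFam Y := by
  refine ⟨fun a b => ⟨?_⟩, h1, fun a b => ⟨?_⟩, h2⟩
  · rw [Matrix.star_eq_conjTranspose, Matrix.conjTranspose_mul, Matrix.conjTranspose_conjTranspose]
    exact h1 _ _ _ _
  · rw [Matrix.star_eq_conjTranspose, Matrix.conjTranspose_mul, Matrix.conjTranspose_conjTranspose]
    exact h2 _ _ _ _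

lemma svd_of_ncf {n k : ℕ} (X : Matrix (Fin n × Fin k) (Fin n × Fin k) ℂ)
    (h : NormalCommFam (fun A : Matrix (Fin n) (Fin n) ℂ => XA X A)) : HasBlockSVD X := by
  obtain ⟨e, f, c, he, hf, hff, hY⟩ := simSVD _ h
  have he' : ∀ i j, star (e i) ⬝ᵥ e j = if i = j then (1 : ℂ) else 0 := he
  have hct : ∀ i, (vecMulVec (e i) (star (f i)))ᴴ = vecMulVec (f i) (star (e i)) := by
    intro i
    rw [Matrix.conjTranspose_vecMulVec, star_star]
  refine ⟨k, fun j => Matrix.of fun p q => c (Matrix.single q p 1) j,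
    fun j => vecMulVec (e j) (star (f j)), ?_, ?_, ?_, ?_⟩
  · intro i
    rw [IsPartialIso, hct]
    simp only [Matrix.vecMulVec_mul_vecMulVec, he', if_true]
    rcases hf i with h | h
    · simp [h]
    · simp [h, Matrix.vecMulVec_mul_vecMulVec, he']
  · intro i j hij
    rw [hct, hct]
    simp [Matrix.vecMulVec_mul_vecMulVec, he', hff i j hij]
  · intro i j hij
    rw [hct, hct]
    rw [Matrix.mul_assoc, ← Matrix.mul_assoc (vecMulVec (f i) _)]
    simp [Matrix.vecMulVec_mul_vecMulVec, he', hij]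
  · ext ⟨p, s⟩ ⟨q, t⟩
    rw [← XA_single X p q s t, hY]
    simp [Matrix.sum_apply]

lemma orth_left {k : ℕ} {R S : Matrix (Fin k) (Fin k) ℂ} (hR : IsPartialIso R)
    (hS : IsPartialIso S) (h : (Rᴴ * R) * (Sᴴ * S) = 0) : R * Sᴴ = 0 := by
  have hS' : Sᴴ * S * Sᴴ = Sᴴ := by
    have := congrArg Matrix.conjTranspose hS
    simpa [Matrix.mul_assoc] using this
  calc R * Sᴴ = (R * Rᴴ * R) * (Sᴴ * S * Sᴴ) := by rw [hR, hS']
    _ = R * ((Rᴴ * R) * (Sᴴ * S)) * Sᴴ := by simp only [Matrix.mul_assoc]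
    _ = 0 := by rw [h]; simp

lemma IsPartialIso.ct {k : ℕ} {R : Matrix (Fin k) (Fin k) ℂ} (hR : IsPartialIso R) :
    IsPartialIso Rᴴ := by
  have := congrArg Matrix.conjTranspose hR
  simpa [IsPartialIso, Matrix.mul_assoc] using this

lemma comm_aux {k p : ℕ} (Rs : Fin p → Matrix (Fin k) (Fin k) ℂ)
    (hR : ∀ i, IsPartialIso (Rs i))
    (h1 : ∀ i j, i ≠ j → ((Rs i)ᴴ * Rs i) * ((Rs j)ᴴ * Rs j) = 0)
    (h2 : ∀ i j, i ≠ j → (Rs i * (Rs i)ᴴ) * (Rs j * (Rs j)ᴴ) = 0)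
    (x y z w : Fin p → ℂ) :
    Commute ((∑ i, x i • Rs i) * (∑ i, y i • Rs i)ᴴ)
      ((∑ i, z i • Rs i) * (∑ i, w i • Rs i)ᴴ) := by
  have key : ∀ x y : Fin p → ℂ, (∑ i, x i • Rs i) * (∑ i, y i • Rs i)ᴴ =
      ∑ i, (x i * star (y i)) • (Rs i * (Rs i)ᴴ) := by
    intro x y
    rw [Matrix.conjTranspose_sum, Finset.sum_mul]
    refine Finset.sum_congr rfl fun i _ => ?_
    rw [Finset.mul_sum, Finset.sum_eq_single i]
    · simp [smul_smul, mul_comm]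
    · intro j _ hj
      simp [orth_left (hR i) (hR j) (h1 i j hj.symm)]
    · simp
  rw [key, key]
  refine Commute.sum_left _ _ _ fun i _ => Commute.sum_right _ _ _ fun j _ => ?_
  refine Commute.smul_left (Commute.smul_right ?_ _) _
  by_cases hij : i = j
  · subst hij; exact Commute.refl _
  · rw [Commute, SemiconjBy, h2 i j hij, h2 j i (Ne.symm hij)]

lemma ncf_of_svd {n k : ℕ} (X : Matrix (Fin n × Fin k) (Fin n × Fin k) ℂ)
    (h : HasBlockSVD X) : NormalCommFam (fun A : Matrix (Fin n) (Fin n) ℂ => XA X A) := by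
  obtain ⟨p, Xs, Rs, hR, h1, h2, rfl⟩ := h
  apply ncf_of
  · intro a b c d
    simp only [XA_kron]
    exact comm_aux Rs hR h1 h2 _ _ _ _
  · intro a b c d
    simp only [XA_kron]
    have := comm_aux (fun i => (Rs i)ᴴ) (fun i => (hR i).ct)
      (by simpa using h2) (by simpa using h1)
      (fun i => star (Xs i * a).trace) (fun i => star (Xs i * b).trace)
      (fun i => star (Xs i * c).trace) (fun i => star (Xs i * d).trace)
    simpa [Matrix.conjTranspose_sum] using this

lemma comm_ext {ι : Type*} [Fintype ι] {k : ℕ} (Z : ι → Matrix (Fin k) (Fin k) ℂ)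
    (h1 : ∀ a b c d, Commute (Z a * (Z b)ᴴ) (Z c * (Z d)ᴴ)) (x y z w : ι → ℂ) :
    Commute ((∑ i, x i • Z i) * (∑ i, y i • Z i)ᴴ)
      ((∑ i, z i • Z i) * (∑ i, w i • Z i)ᴴ) := by
  simp only [Matrix.conjTranspose_sum, Finset.sum_mul, Finset.mul_sum, Matrix.conjTranspose_smul,
    Matrix.smul_mul, Matrix.mul_smul]
  refine Commute.sum_left _ _ _ fun i _ => Commute.sum_left _ _ _ fun j _ =>
    Commute.sum_right _ _ _ fun r _ => Commute.sum_right _ _ _ fun s _ => ?_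
  exact ((((h1 _ _ _ _).smul_left _).smul_left _).smul_right _).smul_right _

lemma HSONB.expand {n : ℕ} {E : Fin (n ^ 2) → Matrix (Fin n) (Fin n) ℂ} (hE : HSONB E)
    (A : Matrix (Fin n) (Fin n) ℂ) : A = ∑ a, (A * E a).trace • (E a)ᴴ := by
  have h : (Matrix.of fun (a : Fin (n ^ 2)) (p : Fin n × Fin n) => star (E a p.1 p.2)) *
      (Matrix.of fun (p : Fin n × Fin n) (a : Fin (n ^ 2)) => E a p.1 p.2) = 1 := by
    ext a b
    rw [Matrix.one_apply, ← hE a b]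
    simp only [Matrix.mul_apply, Matrix.trace, Matrix.diag, Fintype.sum_prod_type,
      Matrix.of_apply, Matrix.conjTranspose_apply]
    rw [Finset.sum_comm]
  replace h := (Matrix.mul_eq_one_comm_of_card_eq _ _ _ (by simp [sq])).mp h
  ext r s
  have h' : ∀ p q, ∑ a, E a q p * star (E a s r) = if q = s ∧ p = r then (1 : ℂ) else 0 := by
    intro p q
    have := congrFun (congrFun h (q, p)) (s, r)
    simpa [Matrix.mul_apply, Matrix.one_apply] using this
  simp only [Matrix.sum_apply, Matrix.smul_apply, smul_eq_mul, Matrix.conjTranspose_apply,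
    Matrix.trace, Matrix.diag, Matrix.mul_apply, Finset.sum_mul]
  rw [Finset.sum_comm]
  have : ∀ p, ∑ a, ∑ q, A p q * E a q p * star (E a s r) =
      ∑ q, A p q * (if q = s ∧ p = r then (1 : ℂ) else 0) := by
    intro p
    rw [Finset.sum_comm]
    refine Finset.sum_congr rfl fun q _ => ?_
    rw [← h', Finset.mul_sum]
    exact Finset.sum_congr rfl fun a _ => by ring
  simp only [this]
  simp [ite_and]

lemma ncf_of_basis {n k : ℕ} (X : Matrix (Fin n × Fin k) (Fin n × Fin k) ℂ)
    {E : Fin (n ^ 2) → Matrix (Fin n) (Fin n) ℂ} (hE : HSONB E)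
    (h : NormalCommFam (fun a => XA X ((E a)ᴴ))) :
    NormalCommFam (fun A : Matrix (Fin n) (Fin n) ℂ => XA X A) := by
  obtain ⟨-, h1, -, h2⟩ := h
  have hx : ∀ A, XA X A = ∑ a, (A * E a).trace • XA X ((E a)ᴴ) := by
    intro A
    conv_lhs => rw [hE.expand A]
    rw [XA_sum]
  apply ncf_of
  · intro a b c d
    simp only [hx a, hx b, hx c, hx d]
    exact comm_ext _ h1 _ _ _ _
  · intro a b c d
    simp only [hx a, hx b, hx c, hx d]
    have := comm_ext (fun a => (XA X ((E a)ᴴ))ᴴ) (by simpa using h2)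
      (fun i => star (a * E i).trace) (fun i => star (b * E i).trace)
      (fun i => star (c * E i).trace) (fun i => star (d * E i).trace)
    simpa only [Matrix.conjTranspose_sum, Matrix.conjTranspose_smul,
      Matrix.conjTranspose_conjTranspose, star_star] using this

lemma exists_HSONB (n : ℕ) : ∃ E : Fin (n ^ 2) → Matrix (Fin n) (Fin n) ℂ, HSONB E := by
  have σ : Fin (n ^ 2) ≃ Fin n × Fin n := Fintype.equivOfCardEq (by simp [sq])
  refine ⟨fun a => Matrix.single (σ a).1 (σ a).2 1, fun a b => ?_⟩
  simp only [← σ.injective.eq_iff (a := a)]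
  generalize σ a = p
  generalize σ b = q
  obtain ⟨p1, p2⟩ := p
  obtain ⟨q1, q2⟩ := q
  rw [Matrix.conjTranspose_single]
  by_cases h1 : p1 = q1
  · subst h1
    by_cases h2 : p2 = q2
    · subst h2; simp
    · simp [h2, Matrix.trace_single_eq_of_ne]
  · simp [h1, Matrix.single_mul_single_of_ne]

/-- a bipartite matrix has a block-diagonal SVD iff the family
`{X_A}` satisfies the normality/commutation conditions, iff those conditions hold
for every (equivalently, some) Hilbert–Schmidt orthonormal basis of `M_n(ℂ)`
(with `X_α := X_{E_α*}`). -/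
theorem stmt19 (n k : ℕ) (X : Matrix (Fin n × Fin k) (Fin n × Fin k) ℂ) :
    (HasBlockSVD X ↔ NormalCommFam (fun A : Matrix (Fin n) (Fin n) ℂ => XA X A)) ∧
    (NormalCommFam (fun A : Matrix (Fin n) (Fin n) ℂ => XA X A) ↔
      (∀ E : Fin (n ^ 2) → Matrix (Fin n) (Fin n) ℂ, HSONB E →
        NormalCommFam (fun a => XA X ((E a)ᴴ)))) ∧
    ((∀ E : Fin (n ^ 2) → Matrix (Fin n) (Fin n) ℂ, HSONB E →
        NormalCommFam (fun a => XA X ((E a)ᴴ))) ↔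
      (∃ E : Fin (n ^ 2) → Matrix (Fin n) (Fin n) ℂ, HSONB E ∧
        NormalCommFam (fun a => XA X ((E a)ᴴ)))) := by
  have h31 : (∃ E : Fin (n ^ 2) → Matrix (Fin n) (Fin n) ℂ, HSONB E ∧
        NormalCommFam (fun a => XA X ((E a)ᴴ))) →
      NormalCommFam (fun A : Matrix (Fin n) (Fin n) ℂ => XA X A) :=
    fun ⟨_, hE, h⟩ => ncf_of_basis X hE h
  have h12 : NormalCommFam (fun A : Matrix (Fin n) (Fin n) ℂ => XA X A) →
      (∀ E : Fin (n ^ 2) → Matrix (Fin n) (Fin n) ℂ, HSONB E →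
        NormalCommFam (fun a => XA X ((E a)ᴴ))) :=
    fun h E _ => ⟨fun _ _ => h.1 _ _, fun _ _ _ _ => h.2.1 _ _ _ _,
      fun _ _ => h.2.2.1 _ _, fun _ _ _ _ => h.2.2.2 _ _ _ _⟩
  have h23 : (∀ E : Fin (n ^ 2) → Matrix (Fin n) (Fin n) ℂ, HSONB E →
        NormalCommFam (fun a => XA X ((E a)ᴴ))) →
      (∃ E : Fin (n ^ 2) → Matrix (Fin n) (Fin n) ℂ, HSONB E ∧
        NormalCommFam (fun a => XA X ((E a)ᴴ))) := by
    intro h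
    obtain ⟨E, hE⟩ := exists_HSONB n
    exact ⟨E, hE, h E hE⟩
  exact ⟨⟨ncf_of_svd X, svd_of_ncf X⟩, ⟨h12, fun h => h31 (h23 h)⟩, ⟨h23, fun h => h12 (h31 h)⟩⟩

end BipartiteUnitary
end
end
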